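/- Let n ≥ 1 and m ≥ 1, let Δ ⊆ Δ' be open polydiscs centered at 0 in ℂⁿ, let ℳ ⊆ ℕⁿ be a co-ideal, let K ≥ 1, and suppose X ⊆ ℂⁿ admits decomposition with respect to (ℳ, Δ, Δ') with norm K. Let e ≥ 1 satisfy #{α ∈ ℳ : |α| = k} ≤ e·L(m,k) for all k ∈ ℕ. Then there exist constants C > 0 and E > 0 depending only on m, K and e with the following property: for every 0 < δ < 1/2, every open polydisc D centered at 0 with D^δ := {δ^{−1}·z : z ∈ D} ⊆ Δ, every integer μ > e, every M > 0, all functions f₁,…,f_μ holomorphic on a neighborhood of the closure of Δ' with sup_{Δ'} |f_i| ≤ M for all i, and all points p₁,…,p_μ ∈ D ∩ X, one has |det (f_i(p_j))_{1≤i,j≤μ}| ≤ (C·μ³·M)^μ · δ^{E·μ^{1+1/m}}. -/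

import Mathlib

open scoped BigOperators

/-- The open polydisc in `ℂⁿ` centered at `0` of polyradius `r`. -/
def polydisc0 {n : ℕ} (r : Fin n → ℝ) : Set (Fin n → ℂ) :=
  {z | ∀ i, ‖z i‖ < r i}

/-- A co-ideal of multi-indices: downward closed under the componentwise order. -/
def IsCoideal {n : ℕ} (ℳ : Set (Fin n → ℕ)) : Prop :=
  ∀ α ∈ ℳ, ∀ β : Fin n → ℕ, (∀ i, β i ≤ α i) → β ∈ ℳ

/-- The monomial `z ^ α`. -/
def mon {n : ℕ} (α : Fin n → ℕ) (z : Fin n → ℂ) : ℂ := ∏ i, z i ^ α i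

/-- `L n k`: the number of monomials of degree exactly `k` in `n` variables. -/
def L (n k : ℕ) : ℕ := (n + k - 1).choose (n - 1)

/-- The data `(c, Q)` witnesses the decomposition of `F` with respect to
`(ℳ, Δ, Δ')` with norm `K`: `Q` is holomorphic on `Δ`, the series
`∑_{α ∈ ℳ} c_α z^α` converges on `Δ`, `F = ∑_{α ∈ ℳ} c_α z^α + Q` on `Δ`,
`Q` vanishes identically on `X ∩ Δ`, and
`sup_Δ ‖c_α z^α‖ ≤ K ⬝ sup_{Δ'} ‖F‖` for every `α ∈ ℳ`. -/
def IsDecompWitness {n : ℕ} (X : Set (Fin n → ℂ)) (ℳ : Set (Fin n → ℕ))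
    (Δ Δ' : Set (Fin n → ℂ)) (K : ℝ) (F : (Fin n → ℂ) → ℂ)
    (c : (Fin n → ℕ) → ℂ) (Q : (Fin n → ℂ) → ℂ) : Prop :=
  DifferentiableOn ℂ Q Δ ∧
  (∀ z ∈ Δ, Summable fun α : ℳ => c α.1 * mon α.1 z) ∧
  (∀ z ∈ Δ, F z = (∑' α : ℳ, c α.1 * mon α.1 z) + Q z) ∧
  (∀ z ∈ X ∩ Δ, Q z = 0) ∧
  (∀ α ∈ ℳ, ∀ z ∈ Δ, ‖c α * mon α z‖ ≤ K * sSup ((fun x => ‖F x‖) '' Δ'))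

/-- `X` admits decomposition with respect to `(ℳ, Δ, Δ')` with norm `K`:
every `F` holomorphic on a neighborhood of the closure of `Δ'` admits a
decomposition witness. -/
def AdmitsDecomposition {n : ℕ} (X : Set (Fin n → ℂ)) (ℳ : Set (Fin n → ℕ))
    (Δ Δ' : Set (Fin n → ℂ)) (K : ℝ) : Prop :=
  ∀ F : (Fin n → ℂ) → ℂ,
    (∃ V : Set (Fin n → ℂ), IsOpen V ∧ closure Δ' ⊆ V ∧ DifferentiableOn ℂ F V) →
    ∃ (c : (Fin n → ℕ) → ℂ) (Q : (Fin n → ℂ) → ℂ), IsDecompWitness X ℳ Δ Δ' K F c Q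

theorem norm_det_le_factorial_mul_prod {ν : Type*} [Fintype ν] [DecidableEq ν]
    (A : Matrix ν ν ℂ) (b : ν → ℝ) (h : ∀ i j, ‖A i j‖ ≤ b i) :
    ‖A.det‖ ≤ (Fintype.card ν).factorial * ∏ i, b i := by
  rw [← Matrix.det_transpose, Matrix.det_apply]
  refine (norm_sum_le _ _).trans ?_
  have hterm : ∀ σ ∈ (Finset.univ : Finset (Equiv.Perm ν)),
      ‖Equiv.Perm.sign σ • ∏ i, A.transpose (σ i) i‖ ≤ ∏ i, b i := by
    intro σ _
    have hsign : ‖Equiv.Perm.sign σ • ∏ i, A.transpose (σ i) i‖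
        = ‖∏ i, A.transpose (σ i) i‖ := by
      rcases Int.units_eq_one_or (Equiv.Perm.sign σ) with h | h <;> simp [h]
    rw [hsign, norm_prod]
    exact Finset.prod_le_prod (fun _ _ => norm_nonneg _) fun i _ => h i (σ i)
  refine (Finset.sum_le_sum hterm).trans (le_of_eq ?_)
  simp [Finset.card_univ, Fintype.card_perm]

/-- A determinant vanishes if too many of its rows lie in the span of few vectors. -/
theorem det_eq_zero_of_rows_mem_span {ν ι : Type*} [Fintype ν] [DecidableEq ν]
    (A : Matrix ν ν ℂ) (S : Finset ν) (T : Finset ι) (v : ι → ν → ℂ)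
    (hS : ∀ i ∈ S, A i ∈ Submodule.span ℂ (v '' T)) (hcard : T.card < S.card) :
    A.det = 0 := by
  classical
  by_contra hdet
  have hli : LinearIndependent ℂ A.row :=
    Matrix.linearIndependent_rows_iff_isUnit.2
      ((Matrix.isUnit_iff_isUnit_det A).2 (isUnit_iff_ne_zero.2 hdet))
  have hliS : LinearIndependent ℂ (fun i : S => A i) :=
    hli.comp (fun i : S => (i : ν)) Subtype.val_injective
  have hle := linearIndependent_le_span' _ hliS (↑(T.image v) : Set (ν → ℂ)) (by
    rintro _ ⟨i, rfl⟩
    simpa using hS i i.2)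
  have hle' : S.card ≤ (T.image v).card := by simpa using hle
  exact absurd (hle'.trans Finset.card_image_le) (not_le.2 hcard)

/-- If the entries of a matrix are series whose `α`-th term has rank one and is at most
`H * s ^ (2 * d α)`, and all but the terms in `T` have `N ≤ d α`, then the determinant is
of order `s ^ (N * (card ν - card T))`. -/
theorem norm_det_tsum_le {ν ι : Type*} [Fintype ν] [DecidableEq ν]
    (d : ι → ℕ) (T : Finset ι) (N : ℕ) (hT : ∀ α, α ∉ T → N ≤ d α)
    (a : ν → ι → ℂ) (v : ι → ν → ℂ) (H s W : ℝ) (hH : 0 ≤ H) (hs0 : 0 ≤ s) (hs1 : s ≤ 1)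
    (hbound : ∀ i α j, ‖a i α * v α j‖ ≤ H * s ^ (2 * d α))
    (hsum : ∀ U : Finset ι, ∑ α ∈ U, s ^ d α ≤ W) :
    ‖Matrix.det (Matrix.of fun i j => ∑' α, a i α * v α j)‖ ≤
      (2 * Fintype.card ν * (H * W)) ^ Fintype.card ν
        * (s ^ N) ^ (Fintype.card ν - T.card) := by
  classical
  have hW : 0 ≤ W := by simpa using hsum ∅
  have hsN0 : 0 ≤ s ^ N := pow_nonneg hs0 N
  have hsN1 : s ^ N ≤ 1 := pow_le_one₀ hs0 hs1
  have hsm : Summable fun α => s ^ d α :=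
    summable_of_sum_le (fun _ => pow_nonneg hs0 _) hsum
  have hle2 : ∀ α, s ^ (2 * d α) ≤ s ^ d α := fun α =>
    pow_le_pow_of_le_one hs0 hs1 (by omega)
  have hsma : ∀ i j, Summable fun α => a i α * v α j := fun i j =>
    Summable.of_norm_bounded (hsm.mul_left H) fun α =>
      (hbound i α j).trans (mul_le_mul_of_nonneg_left (hle2 α) hH)
  let B : ν → ν → ℂ := fun i j => ∑ α ∈ T, a i α * v α j
  let R : ν → ν → ℂ := fun i j => ∑' α : ((T : Set ι)ᶜ : Set ι), a i α * v α j
  have hB : ∀ i j, ‖B i j‖ ≤ H * W := by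
    intro i j
    refine (norm_sum_le _ _).trans ?_
    refine (Finset.sum_le_sum fun α _ =>
      (hbound i α j).trans (mul_le_mul_of_nonneg_left (hle2 α) hH)).trans ?_
    rw [← Finset.mul_sum]
    exact mul_le_mul_of_nonneg_left (hsum T) hH
  have hR : ∀ i j, ‖R i j‖ ≤ H * W * s ^ N := by
    intro i j
    have hsm' : Summable fun α : ((T : Set ι)ᶜ : Set ι) => s ^ d α := hsm.subtype _
    have hle : ‖R i j‖ ≤ H * s ^ N * ∑' α : ((T : Set ι)ᶜ : Set ι), s ^ d α := by
      refine tsum_of_norm_bounded (hsm'.hasSum.mul_left (H * s ^ N)) fun α => ?_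
      refine (hbound i α j).trans ?_
      rw [two_mul, pow_add, mul_assoc]
      have hα : s ^ d α ≤ s ^ N :=
        pow_le_pow_of_le_one hs0 hs1 (hT α fun hα => α.2 hα)
      have := pow_nonneg hs0 (d α)
      gcongr
    have hts : ∑' α : ((T : Set ι)ᶜ : Set ι), s ^ d α ≤ W := by
      refine Real.tsum_le_of_sum_le (fun _ => pow_nonneg hs0 _) fun U => ?_
      have := hsum (U.map (Function.Embedding.subtype _))
      simpa using this
    calc ‖R i j‖ ≤ H * s ^ N * W :=
          hle.trans (mul_le_mul_of_nonneg_left hts (mul_nonneg hH hsN0))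
      _ = H * W * s ^ N := by ring
  have hsplit : (Matrix.of fun i j => ∑' α, a i α * v α j) = Matrix.of (B + R) := by
    ext i j
    exact ((hsma i j).sum_add_tsum_compl (s := T)).symm
  have hexpand : Matrix.det (Matrix.of (B + R)) =
      ∑ S : Finset ν, Matrix.det (Matrix.of (S.piecewise B R)) :=
    (Matrix.detRowAlternating (R := ℂ) (n := ν)).toMultilinearMap.map_add_univ B R
  have hterm : ∀ S : Finset ν, ‖Matrix.det (Matrix.of (S.piecewise B R))‖ ≤
      (Fintype.card ν : ℝ) ^ Fintype.card ν *
        ((H * W) ^ Fintype.card ν * (s ^ N) ^ (Fintype.card ν - T.card)) := by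
    intro S
    have hHW : 0 ≤ H * W := mul_nonneg hH hW
    rcases lt_or_ge T.card S.card with hlt | hge
    · rw [det_eq_zero_of_rows_mem_span _ S T v _ hlt]
      · rw [norm_zero]
        positivity
      · intro i hi
        have hrow : Matrix.of (S.piecewise B R) i = ∑ α ∈ T, a i α • v α := by
          ext j
          simp [Finset.piecewise_eq_of_mem _ _ _ hi, B]
        rw [hrow]
        exact Submodule.sum_mem _ fun α hα => Submodule.smul_mem _ _
          (Submodule.subset_span ⟨α, hα, rfl⟩)
    · have hdet := norm_det_le_factorial_mul_prod (Matrix.of (S.piecewise B R))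
        (S.piecewise (fun _ => H * W) fun _ => H * W * s ^ N) (by
          intro i j
          by_cases hi : i ∈ S
          · simpa [hi] using hB i j
          · simpa [hi] using hR i j)
      have hprod : ∏ i, S.piecewise (fun _ => H * W) (fun _ => H * W * s ^ N) i =
          (H * W) ^ Fintype.card ν * (s ^ N) ^ (Fintype.card ν - S.card) := by
        rw [Finset.prod_piecewise, Finset.prod_const, Finset.prod_const, Finset.univ_inter,
          ← Finset.compl_eq_univ_sdiff, Finset.card_compl, mul_pow (H * W), ← mul_assoc, ← pow_add,
          Nat.add_sub_cancel' S.card_le_univ]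
      rw [hprod] at hdet
      refine hdet.trans ?_
      have hfac : ((Fintype.card ν).factorial : ℝ) ≤ (Fintype.card ν : ℝ) ^ Fintype.card ν :=
        mod_cast Nat.factorial_le_pow _
      have hpow : (s ^ N) ^ (Fintype.card ν - S.card) ≤ (s ^ N) ^ (Fintype.card ν - T.card) :=
        pow_le_pow_of_le_one hsN0 hsN1 (by omega)
      gcongr
  rw [hsplit, hexpand]
  refine (norm_sum_le _ _).trans ((Finset.sum_le_sum fun S _ => hterm S).trans (le_of_eq ?_))
  rw [Finset.sum_const, Finset.card_univ, Fintype.card_finset, nsmul_eq_mul, mul_pow, mul_pow]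
  push_cast
  ring

theorem choose_add_le_succ_pow (n k : ℕ) : (n + k).choose n ≤ (k + 1) ^ n := by
  induction n with
  | zero => simp
  | succ n ih =>
    have h := Nat.add_one_mul_choose_eq (n + k) n
    have hcomm : n + 1 + k = n + k + 1 := by omega
    rw [hcomm]
    refine Nat.le_of_mul_le_mul_right ?_ (Nat.succ_pos n)
    rw [Nat.succ_eq_add_one, ← h, pow_succ]
    calc (n + k + 1) * (n + k).choose n ≤ ((k + 1) * (n + 1)) * (k + 1) ^ n :=
          Nat.mul_le_mul (by nlinarith) ih
      _ = (k + 1) ^ n * (k + 1) * (n + 1) := by ring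

theorem L_le_succ_pow {m : ℕ} (hm : 1 ≤ m) (k : ℕ) : L m k ≤ (k + 1) ^ (m - 1) := by
  have h : m + k - 1 = m - 1 + k := by omega
  rw [L, h]
  exact choose_add_le_succ_pow _ _

/-- Summation by degree, for a family with at most `g k` members of each degree `k`. -/
theorem sum_comp_degree_le {ι : Type*} (d : ι → ℕ) (g : ℕ → ℕ)
    (hd : ∀ (k : ℕ) (T : Finset ι), (∀ α ∈ T, d α = k) → T.card ≤ g k)
    (w : ℕ → ℝ) (hw : ∀ k, 0 ≤ w k) (T : Finset ι) (J : Finset ℕ) (hJ : ∀ α ∈ T, d α ∈ J) :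
    ∑ α ∈ T, w (d α) ≤ ∑ k ∈ J, g k * w k := by
  rw [← Finset.sum_fiberwise_of_maps_to hJ]
  refine Finset.sum_le_sum fun k _ => ?_
  have hconst : ∑ α ∈ T with d α = k, w (d α) = ∑ α ∈ T with d α = k, w k :=
    Finset.sum_congr rfl fun α hα => by rw [(Finset.mem_filter.1 hα).2]
  rw [hconst, Finset.sum_const, nsmul_eq_mul]
  exact mul_le_mul_of_nonneg_right
    (mod_cast hd k _ fun α hα => (Finset.mem_filter.1 hα).2) (hw k)

theorem summable_succ_pow_mul_geometric (j : ℕ) {q : ℝ} (hq0 : 0 < q) (hq1 : q < 1) :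
    Summable fun k : ℕ => ((k : ℝ) + 1) ^ j * q ^ k := by
  have h := summable_pow_mul_geometric_of_norm_lt_one j
    (r := q) (by rwa [Real.norm_of_nonneg hq0.le])
  have h' := ((summable_nat_add_iff 1).2 h).mul_left q⁻¹
  refine h'.congr fun k => ?_
  push_cast
  rw [pow_succ]
  field_simp

theorem finite_setOf_degree_le {n : ℕ} (k : ℕ) : {α : Fin n → ℕ | ∑ i, α i ≤ k}.Finite :=
  (Set.finite_Iic (fun _ : Fin n => k)).subset fun α hα i =>
    (Finset.single_le_sum (f := α) (fun _ _ => Nat.zero_le _) (Finset.mem_univ i)).trans hα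

theorem mon_smul {n : ℕ} (α : Fin n → ℕ) (t : ℂ) (z : Fin n → ℂ) :
    mon α (t • z) = t ^ (∑ i, α i) * mon α z := by
  simp [mon, mul_pow, Finset.prod_mul_distrib, Finset.prod_pow_eq_pow_sum]

/-- A truncation order `N` below which a family of at most `e * N ^ m` indices leaves
a proportion of the `μ` rows, with `N` of order `μ ^ (1 / m)`. -/
theorem exists_truncation_order {m e μ : ℕ} (hm : 1 ≤ m) (hμ : e < μ) :
    ∃ N : ℕ, ∀ t : ℕ, t ≤ e * N ^ m →
      (1 / (2 * ((e : ℝ) + 1) ^ 2)) * (μ : ℝ) ^ (1 + 1 / (m : ℝ)) ≤ (N * (μ - t : ℕ) : ℕ) := by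
  have he0 : (0 : ℝ) < (e : ℝ) + 1 := by positivity
  have hμ0 : (0 : ℝ) < μ := by exact_mod_cast (Nat.zero_le e).trans_lt hμ
  have hm0 : (m : ℝ) ≠ 0 := by positivity
  have hm1 : 1 / (m : ℝ) ≤ 1 := by
    rw [div_le_one (by positivity)]
    exact_mod_cast hm
  set x : ℝ := μ / ((e : ℝ) + 1) with hx
  have hx1 : 1 ≤ x := by
    rw [hx, one_le_div he0]
    exact_mod_cast hμ
  set y : ℝ := x ^ (1 / (m : ℝ)) with hy
  have hy1 : 1 ≤ y := Real.one_le_rpow hx1 (by positivity)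
  have hyN : y ^ m = x := by
    rw [hy, ← Real.rpow_natCast, ← Real.rpow_mul (by positivity), one_div_mul_cancel hm0,
      Real.rpow_one]
  refine ⟨⌊y⌋₊, fun t ht => ?_⟩
  have hNy : (⌊y⌋₊ : ℝ) ≤ y := Nat.floor_le (by positivity)
  have hN1 : (1 : ℝ) ≤ ⌊y⌋₊ := by exact_mod_cast (Nat.one_le_floor_iff y).2 hy1
  have hN2 : y / 2 ≤ ⌊y⌋₊ := by
    have := Nat.lt_floor_add_one y
    linarith
  have htx : (t : ℝ) ≤ e * x := by
    have h1 : (t : ℝ) ≤ e * (⌊y⌋₊ : ℝ) ^ m := by exact_mod_cast ht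
    have h2 : (⌊y⌋₊ : ℝ) ^ m ≤ x := hyN ▸ pow_le_pow_left₀ (by positivity) hNy m
    exact h1.trans (mul_le_mul_of_nonneg_left h2 (by positivity))
  have hμx : (μ : ℝ) = ((e : ℝ) + 1) * x := by
    rw [hx]
    field_simp
  have hxt : x ≤ ((μ - t : ℕ) : ℝ) := by
    have : ((μ : ℝ) - t) ≤ ((μ - t : ℕ) : ℝ) := by
      rw [sub_le_iff_le_add]
      exact_mod_cast (by omega : μ ≤ μ - t + t)
    nlinarith
  have hμpow : (μ : ℝ) ^ (1 / (m : ℝ)) ≤ ((e : ℝ) + 1) * y := by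
    rw [hμx, Real.mul_rpow he0.le (by positivity)]
    refine mul_le_mul_of_nonneg_right ?_ (by positivity)
    exact Real.rpow_le_self_of_one_le (by linarith [Nat.cast_nonneg (α := ℝ) e]) hm1
  rw [Real.rpow_add hμ0, Real.rpow_one]
  push_cast
  calc 1 / (2 * ((e : ℝ) + 1) ^ 2) * (μ * (μ : ℝ) ^ (1 / (m : ℝ)))
      ≤ 1 / (2 * ((e : ℝ) + 1) ^ 2) * ((((e : ℝ) + 1) * x) * (((e : ℝ) + 1) * y)) := by
        rw [← hμx]
        gcongr
    _ = y / 2 * x := by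
        field_simp
    _ ≤ ⌊y⌋₊ * ((μ - t : ℕ) : ℝ) := by gcongr

theorem interpolation_determinant_upper_bound
    (m : ℕ) (hm : 1 ≤ m) (K : ℝ) (hK : 1 ≤ K) (e : ℕ) (he : 1 ≤ e) :
    ∃ C > (0 : ℝ), ∃ E > (0 : ℝ), ∀ n : ℕ, 1 ≤ n →
      ∀ rΔ rΔ' : Fin n → ℝ, (∀ i, 0 < rΔ i) → (∀ i, 0 < rΔ' i) →
      polydisc0 rΔ ⊆ polydisc0 rΔ' →
      ∀ ℳ : Set (Fin n → ℕ), IsCoideal ℳ →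
      ∀ X : Set (Fin n → ℂ),
      AdmitsDecomposition X ℳ (polydisc0 rΔ) (polydisc0 rΔ') K →
      (∀ k : ℕ, ({α ∈ ℳ | (∑ i, α i) = k}).ncard ≤ e * L m k) →
      ∀ δ : ℝ, 0 < δ → δ < 1 / 2 →
      ∀ rD : Fin n → ℝ, (∀ i, 0 < rD i) →
      (fun z => (δ⁻¹ : ℂ) • z) '' polydisc0 rD ⊆ polydisc0 rΔ →
      ∀ μ : ℕ, e < μ → ∀ M : ℝ, 0 < M →
      ∀ f : Fin μ → (Fin n → ℂ) → ℂ,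
      (∀ i, ∃ V : Set (Fin n → ℂ), IsOpen V ∧ closure (polydisc0 rΔ') ⊆ V ∧
        DifferentiableOn ℂ (f i) V) →
      (∀ i, ∀ z ∈ polydisc0 rΔ', ‖f i z‖ ≤ M) →
      ∀ p : Fin μ → (Fin n → ℂ), (∀ j, p j ∈ polydisc0 rD ∩ X) →
      ‖Matrix.det (Matrix.of fun i j => f i (p j))‖ ≤
        (C * (μ : ℝ) ^ 3 * M) ^ μ * δ ^ (E * (μ : ℝ) ^ (1 + 1 / (m : ℝ))) := by
  have hgeom : Summable fun k : ℕ => ((k : ℝ) + 1) ^ (m - 1) * (3 / 4 : ℝ) ^ k :=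
    summable_succ_pow_mul_geometric _ (by norm_num) (by norm_num)
  set G : ℝ := ∑' k : ℕ, ((k : ℝ) + 1) ^ (m - 1) * (3 / 4 : ℝ) ^ k
  have hG : 0 < G := hgeom.tsum_pos (fun k => by positivity) 0 (by positivity)
  have he0 : (0 : ℝ) < e := by exact_mod_cast he
  have hK0 : 0 < K := one_pos.trans_le hK
  refine ⟨2 * (K * (e * G)), by positivity, 1 / (4 * ((e : ℝ) + 1) ^ 2), by positivity, ?_⟩
  intro n _ rΔ rΔ' hrΔ hrΔ' _ ℳ _ X hX hcount δ hδ0 hδ rD _ hD μ hμ M hM f hf hfM p hp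
  choose c Q _ _ hFeq hQ hc using fun i => hX (f i) (hf i)
  let d : ℳ → ℕ := fun α => ∑ i, α.1 i
  have hδC : (δ : ℂ) ≠ 0 := by exact_mod_cast hδ0.ne'
  have hscaled : ∀ j, ((δ : ℂ)⁻¹ • p j) ∈ polydisc0 rΔ := fun j => hD ⟨p j, (hp j).1, rfl⟩
  have hpΔ : ∀ j, p j ∈ polydisc0 rΔ := by
    intro j i
    refine lt_of_le_of_lt ?_ (hscaled j i)
    rw [Pi.smul_apply, smul_eq_mul, norm_mul, norm_inv, Complex.norm_real,
      Real.norm_of_nonneg hδ0.le]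
    exact le_mul_of_one_le_left (norm_nonneg _) ((one_le_inv₀ hδ0).2 (by linarith))
  have hsup : ∀ i, sSup ((fun x => ‖f i x‖) '' polydisc0 rΔ') ≤ M := by
    intro i
    refine csSup_le ⟨_, 0, fun k => by simpa using hrΔ' k, rfl⟩ ?_
    rintro _ ⟨z, hz, rfl⟩
    exact hfM i z hz
  set s : ℝ := √δ with hs
  have hs0 : 0 < s := Real.sqrt_pos.2 hδ0
  have hsδ : s ^ 2 = δ := Real.sq_sqrt hδ0.le
  have hs34 : s ≤ 3 / 4 := by nlinarith
  have hbound : ∀ i (α : ℳ) j, ‖c i α * mon α.1 (p j)‖ ≤ K * M * s ^ (2 * d α) := by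
    intro i α j
    have hpj : p j = (δ : ℂ) • ((δ : ℂ)⁻¹ • p j) := by rw [smul_inv_smul₀ hδC]
    have hmon : c i α * mon α.1 (p j) =
        (δ : ℂ) ^ d α * (c i α * mon α.1 ((δ : ℂ)⁻¹ • p j)) := by
      conv_lhs => rw [hpj, mon_smul]
      ring
    rw [hmon, norm_mul, norm_pow, Complex.norm_real, Real.norm_of_nonneg hδ0.le, pow_mul, hsδ,
      mul_comm]
    exact mul_le_mul_of_nonneg_right ((hc i α α.2 _ (hscaled j)).trans
      (mul_le_mul_of_nonneg_left (hsup i) hK0.le)) (by positivity)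
  have hdeg : ∀ (k : ℕ) (T : Finset ℳ), (∀ α ∈ T, d α = k) →
      T.card ≤ e * (k + 1) ^ (m - 1) := by
    intro k T hTk
    have hfin : ({α ∈ ℳ | (∑ i, α i) = k}).Finite :=
      (finite_setOf_degree_le k).subset fun α hα => hα.2.le
    calc T.card = (T.map (Function.Embedding.subtype _)).card := (Finset.card_map _).symm
      _ = ((T.map (Function.Embedding.subtype _) : Finset (Fin n → ℕ)) :
            Set (Fin n → ℕ)).ncard := (Set.ncard_coe_finset _).symm
      _ ≤ ({α ∈ ℳ | (∑ i, α i) = k}).ncard := by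
          refine Set.ncard_le_ncard (fun α hα => ?_) hfin
          obtain ⟨β, hβ, rfl⟩ := Finset.mem_map.1 (Finset.mem_coe.1 hα)
          exact ⟨β.2, hTk β hβ⟩
      _ ≤ e * L m k := hcount k
      _ ≤ e * (k + 1) ^ (m - 1) := Nat.mul_le_mul_left _ (L_le_succ_pow hm k)
  have hsum : ∀ U : Finset ℳ, ∑ α ∈ U, s ^ d α ≤ e * G := by
    intro U
    refine (sum_comp_degree_le d _ hdeg (fun k => s ^ k) (fun k => by positivity) U
      (U.image d) fun α hα => Finset.mem_image_of_mem d hα).trans ?_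
    calc ∑ k ∈ U.image d, ((e * (k + 1) ^ (m - 1) : ℕ) : ℝ) * s ^ k
        ≤ ∑ k ∈ U.image d, e * (((k : ℝ) + 1) ^ (m - 1) * (3 / 4 : ℝ) ^ k) := by
          refine Finset.sum_le_sum fun k _ => ?_
          push_cast
          rw [mul_assoc]
          gcongr
      _ = e * ∑ k ∈ U.image d, ((k : ℝ) + 1) ^ (m - 1) * (3 / 4 : ℝ) ^ k := by
          rw [Finset.mul_sum]
      _ ≤ e * G := by
          refine mul_le_mul_of_nonneg_left ?_ he0.le
          exact hgeom.sum_le_tsum _ fun k _ => by positivity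
  obtain ⟨N, hN⟩ := exists_truncation_order hm hμ
  have hlow : {α : ℳ | d α < N}.Finite :=
    ((finite_setOf_degree_le N).preimage Subtype.val_injective.injOn).subset
      fun α hα => (show d α < N from hα).le
  have hmemT : ∀ α : ℳ, α ∈ hlow.toFinset ↔ d α < N := fun α => by simp
  have hTcard : hlow.toFinset.card ≤ e * N ^ m := by
    have h1 := sum_comp_degree_le d _ hdeg (fun _ => 1) (fun _ => zero_le_one) hlow.toFinset
      (Finset.range N) fun α hα => Finset.mem_range.2 ((hmemT α).1 hα)
    simp only [Finset.sum_const, nsmul_eq_mul, mul_one] at h1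
    have h2 : hlow.toFinset.card ≤ ∑ k ∈ Finset.range N, e * (k + 1) ^ (m - 1) := by
      exact_mod_cast h1
    refine h2.trans ((Finset.sum_le_card_nsmul _ _ (e * N ^ (m - 1)) fun k hk =>
      Nat.mul_le_mul_left _ (Nat.pow_le_pow_left (Finset.mem_range.1 hk) _)).trans
        (le_of_eq ?_))
    rw [Finset.card_range, smul_eq_mul, mul_left_comm, ← pow_succ', Nat.sub_add_cancel hm]
  have hentries : (Matrix.of fun i j => f i (p j)) =
      Matrix.of fun i j => ∑' α : ℳ, c i α * mon α.1 (p j) := by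
    ext i j
    simp only [Matrix.of_apply]
    rw [hFeq i _ (hpΔ j), hQ i _ ⟨(hp j).2, hpΔ j⟩, add_zero]
  have hdet := norm_det_tsum_le d hlow.toFinset N
    (fun α hα => not_lt.1 fun h => hα ((hmemT α).2 h))
    (fun i α => c i α.1) (fun α j => mon α.1 (p j)) (K * M) s (e * G) (by positivity)
    hs0.le (by linarith) hbound hsum
  rw [Fintype.card_fin] at hdet
  rw [hentries]
  refine hdet.trans ?_
  have hμ1 : (1 : ℝ) ≤ μ := by exact_mod_cast (Nat.zero_le e).trans_lt hμ
  have hbase : 2 * μ * (K * M * (e * G)) ≤ 2 * (K * (e * G)) * (μ : ℝ) ^ 3 * M := by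
    have hμ3 : (μ : ℝ) ≤ (μ : ℝ) ^ 3 := le_self_pow₀ hμ1 (by norm_num)
    calc 2 * μ * (K * M * (e * G)) = 2 * (K * (e * G)) * μ * M := by ring
      _ ≤ 2 * (K * (e * G)) * (μ : ℝ) ^ 3 * M := by gcongr
  have hexp : (s ^ N) ^ (μ - hlow.toFinset.card) ≤
      δ ^ (1 / (4 * ((e : ℝ) + 1) ^ 2) * (μ : ℝ) ^ (1 + 1 / (m : ℝ))) := by
    rw [← pow_mul, hs, Real.sqrt_eq_rpow, ← Real.rpow_natCast, ← Real.rpow_mul hδ0.le]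
    refine Real.rpow_le_rpow_of_exponent_ge hδ0 (by linarith) ?_
    calc 1 / (4 * ((e : ℝ) + 1) ^ 2) * (μ : ℝ) ^ (1 + 1 / (m : ℝ))
        = 1 / 2 * (1 / (2 * ((e : ℝ) + 1) ^ 2) * (μ : ℝ) ^ (1 + 1 / (m : ℝ))) := by
          field_simp
          ring
      _ ≤ _ := mul_le_mul_of_nonneg_left (hN _ hTcard) (by norm_num)
  gcongr
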